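/- Let (X,d) be a metric space, x₀ ∈ X, and let Λ be a set of geodesic rays in X based at x₀ such that for any two distinct r,r' ∈ Λ the function t ↦ d(r(t),r'(t)) is convex on [0,∞). Fix A > 0 and let d_A be the metric on Λ given by d_A(r,r') := 1/t_A(r,r') for r ≠ r' (where t_A(r,r') is the unique t > 0 with d(r(t),r'(t)) = A) and d_A(r,r) := 0. Then the topology on Λ induced by d_A coincides with the topology generated by the sets U(r,u,ε) := { r' ∈ Λ : d(r(u),r'(u)) < ε } for r ∈ Λ, u > 0, ε > 0 (the cone topology on Λ). -/

import Mathlib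

open scoped Classical

/-- A convex function on `[0, ∞)` vanishing at `0` has slope from the origin nondecreasing. -/
lemma ConvexOn.mul_le_mul_of_map_zero {f : ℝ → ℝ} (hf : ConvexOn ℝ (Set.Ici 0) f)
    (h0 : f 0 = 0) {s t : ℝ} (hs : 0 ≤ s) (hst : s ≤ t) : f s * t ≤ s * f t := by
  rcases (hs.trans hst).eq_or_lt with rfl | ht
  · simp [le_antisymm hst hs, h0]
  · have h := hf.2 (Set.mem_Ici.2 le_rfl) (Set.mem_Ici.2 ht.le)
      (sub_nonneg.2 ((div_le_one ht).2 hst)) (div_nonneg hs ht.le) (sub_add_cancel 1 (s / t))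
    simp only [smul_eq_mul, mul_zero, zero_add, h0, div_mul_cancel₀ s ht.ne'] at h
    calc f s * t ≤ s / t * f t * t := mul_le_mul_of_nonneg_right h ht.le
      _ = s * f t := by field_simp

/-- With `Λ` (the set `S`) a set of geodesic rays based at `x₀` with pairwise convex
distance functions, `A > 0`, and `d_A` the associated metric, the topology on `Λ`
induced by `d_A` (generated by its open balls) coincides with the cone topology,
i.e. the topology generated by the sets `U(r,u,ε) = {r' : dist (r u) (r' u) < ε}`
for `r ∈ Λ`, `u > 0`, `ε > 0`. -/
theorem dA_topology_eq_cone_topology {X : Type*} [MetricSpace X] (x₀ : X)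
    (S : Set (ℝ → X))
    (hray : ∀ r ∈ S, r 0 = x₀ ∧ ∀ s t : ℝ, 0 ≤ s → 0 ≤ t → dist (r s) (r t) = |s - t|)
    (hconv : ∀ r ∈ S, ∀ r' ∈ S, r ≠ r' →
      ConvexOn ℝ (Set.Ici 0) (fun t => dist (r t) (r' t)))
    (A : ℝ) (hA : 0 < A)
    (tA : (ℝ → X) → (ℝ → X) → ℝ)
    (htA : ∀ r ∈ S, ∀ r' ∈ S, r ≠ r' →
      0 < tA r r' ∧ dist (r (tA r r')) (r' (tA r r')) = A) :
    let dA : (ℝ → X) → (ℝ → X) → ℝ := fun r r' => if r = r' then 0 else (tA r r')⁻¹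
    TopologicalSpace.generateFrom
        {V : Set ↥S | ∃ (r : ↥S) (ρ : ℝ), 0 < ρ ∧ V = {r' : ↥S | dA r.1 r'.1 < ρ}}
      = TopologicalSpace.generateFrom
        {V : Set ↥S | ∃ (r : ↥S) (u ε : ℝ), 0 < u ∧ 0 < ε ∧
          V = {r' : ↥S | dist (r.1 u) (r'.1 u) < ε}} := by
  intro dA
  have hslope : ∀ r ∈ S, ∀ r' ∈ S, r ≠ r' → ∀ s t : ℝ, 0 ≤ s → s ≤ t →
      dist (r s) (r' s) * t ≤ s * dist (r t) (r' t) := fun r hr r' hr' hne s t hs hst =>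
    (hconv r hr r' hr' hne).mul_le_mul_of_map_zero
      (by simp [(hray r hr).1, (hray r' hr').1]) hs hst
  have hball : ∀ (r r' : S) (ρ : ℝ), 0 < ρ →
      (dA r.1 r'.1 < ρ ↔ dist (r.1 ρ⁻¹) (r'.1 ρ⁻¹) < A) := by
    rintro ⟨r, hr⟩ ⟨r', hr'⟩ ρ hρ
    by_cases hne : r = r'
    · simp [dA, hne, hρ, hA]
    obtain ⟨hpos, hval⟩ := htA r hr r' hr' hne
    have hρ' : 0 < ρ⁻¹ := inv_pos.2 hρ
    simp only [dA, if_neg hne]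
    rw [inv_lt_comm₀ hpos hρ]
    constructor
    · intro hlt
      have h := hslope r hr r' hr' hne _ _ hρ'.le hlt.le
      rw [hval] at h
      nlinarith
    · intro hlt
      by_contra! hle
      have h := hslope r hr r' hr' hne _ _ hpos.le hle
      rw [hval] at h
      nlinarith
  apply le_antisymm
  · refine le_generateFrom ?_
    rintro _ ⟨r, u, ε, hu, hε, rfl⟩
    refine (@isOpen_iff_forall_mem_open _ (TopologicalSpace.generateFrom _) _).2 fun r' hr' => ?_
    have hδ : 0 < ε - dist (r.1 u) (r'.1 u) := sub_pos.2 hr'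
    set δ := ε - dist (r.1 u) (r'.1 u)
    set T := max u (u * A / δ)
    have hTpos : 0 < T := hu.trans_le (le_max_left _ _)
    refine ⟨{r'' : S | dA r'.1 r''.1 < T⁻¹}, fun r'' hr'' => ?_,
      TopologicalSpace.isOpen_generateFrom_of_mem ⟨r', T⁻¹, inv_pos.2 hTpos, rfl⟩, ?_⟩
    · have hlt : dist (r'.1 u) (r''.1 u) < δ := by
        by_cases hne : r'.1 = r''.1
        · simpa [hne] using hδ
        have hA' := (hball r' r'' _ (inv_pos.2 hTpos)).1 hr''
        rw [inv_inv] at hA'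
        have h := hslope _ r'.2 _ r''.2 hne u T hu.le (le_max_left _ _)
        have hTδ : u * A ≤ T * δ := (div_le_iff₀ hδ).1 (le_max_right _ _)
        have huA := mul_lt_mul_of_pos_left hA' hu
        refine lt_of_mul_lt_mul_right ?_ hTpos.le
        linarith
      have htri := dist_triangle (r.1 u) (r'.1 u) (r''.1 u)
      change dist (r.1 u) (r''.1 u) < ε
      linarith
    · simpa [dA] using hTpos
  · refine le_generateFrom ?_
    rintro _ ⟨r, ρ, hρ, rfl⟩
    exact TopologicalSpace.isOpen_generateFrom_of_mem
      ⟨r, ρ⁻¹, A, inv_pos.2 hρ, hA, Set.ext fun r' => hball r r' ρ hρ⟩
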